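/- arXiv:2111.10880 — 2 statements merged into one kernel-verified Lean document; each statement's English description precedes it below -/
import Mathlib

section
/- Let m ≥ 2 and let φ = (φ_n)_{n=0}^∞ ∈ 𝒢 be such that r = 0 is the only zero of φ_1 in [0,1). Then the Bohr radius R_φ(𝔻, ℂ^m_∞) = inf{ R_φ(f, 𝔻, ℂ^m_∞) : f analytic on 𝔻 with values in ℂ^m_∞, ‖f(z)‖_∞ ≤ 1 on 𝔻 } is equal to 0, where for f(z) = Σ_{n=0}^∞ x_n z^n one sets R_φ(f, 𝔻, ℂ^m_∞) = sup{ r ≥ 0 : Σ_{n=0}^∞ ‖x_n‖_∞ φ_n(r) ≤ φ_0(r) }. -/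
open Filter Metric Set

/-- Let `m ≥ 2` and `φ = (φ_n) ∈ 𝒢` be such that `r = 0` is the only zero of `φ_1` in `[0,1)`.
Then the Bohr radius `R_φ(𝔻, ℂ^m_∞)` equals `0`. Here `ℂ^m_∞` is modelled as `Fin m → ℂ` with
the sup norm (the norm of the Pi type). -/
theorem bohr_radius_sup_norm_eq_zero (m : ℕ) (hm : 2 ≤ m) (φ : ℕ → ℝ → ℝ)
    (hφpos : ∀ n, ∀ r ∈ Ico (0:ℝ) 1, 0 ≤ φ n r)
    (hφcont : ∀ n, ContinuousOn (φ n) (Ico (0:ℝ) 1))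
    (hφconv : TendstoLocallyUniformlyOn
      (fun N r => ∑ n ∈ Finset.range N, φ n r)
      (fun r => ∑' n, φ n r) atTop (Ico (0:ℝ) 1))
    (hφ1 : ∀ r ∈ Ico (0:ℝ) 1, φ 1 r = 0 → r = 0) :
    sInf { R : ℝ | ∃ (f : ℂ → (Fin m → ℂ)) (x : ℕ → Fin m → ℂ),
        (∀ z ∈ ball (0:ℂ) 1, HasSum (fun n => z ^ n • x n) (f z)) ∧
        (∀ z ∈ ball (0:ℂ) 1, ‖f z‖ ≤ 1) ∧
        R = sSup { r : ℝ | 0 ≤ r ∧ r < 1 ∧ ∑' n, ‖x n‖ * φ n r ≤ φ 0 r } } = 0 := by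
  refine IsLeast.csInf_eq ⟨?_, ?_⟩
  · let i₀ : Fin m := ⟨0, by omega⟩
    let i₁ : Fin m := ⟨1, by omega⟩
    have hne : i₀ ≠ i₁ := by simp [i₀, i₁]
    let x : ℕ → Fin m → ℂ := fun n =>
      if n = 0 then Pi.single i₀ 1 else if n = 1 then Pi.single i₁ 1 else 0
    have hx : ∀ n ∉ Finset.range 2, x n = 0 := by
      intro n hn
      have h2 : 1 < n := by simpa using hn
      simp [x, show n ≠ 0 by omega, show n ≠ 1 by omega]
    have hx0 : x 0 = Pi.single i₀ 1 := by simp [x]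
    have hx1 : x 1 = Pi.single i₁ 1 := by simp [x]
    refine ⟨fun z => ∑ n ∈ Finset.range 2, z ^ n • x n, x, fun z _ => ?_, fun z hz => ?_, ?_⟩
    · exact hasSum_sum_of_ne_finset_zero fun n hn => by rw [hx n hn, smul_zero]
    · have hz1 : ‖z‖ ≤ 1 := by simpa using (mem_ball_zero_iff.mp hz).le
      refine (pi_norm_le_iff_of_nonneg zero_le_one).mpr fun i => ?_
      simp only [Finset.sum_range_succ, Finset.sum_range_zero, hx0, hx1, zero_add, pow_zero,
        one_smul, pow_one, Pi.add_apply, Pi.smul_apply, Pi.single_apply, smul_eq_mul]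
      by_cases h0 : i = i₀
      · simp [h0, hne]
      · by_cases h1 : i = i₁
        · simpa [h1, hne.symm] using hz1
        · simp [h0, h1]
    · refine le_antisymm (Real.sSup_nonneg fun r hr => hr.1) (Real.sSup_nonpos ?_)
      rintro r ⟨hr0, hr1, hr⟩
      rw [tsum_eq_sum (s := Finset.range 2) fun n hn => by rw [hx n hn, norm_zero, zero_mul]] at hr
      simp only [Finset.sum_range_succ, Finset.sum_range_zero, hx0, hx1, Pi.norm_single,
        norm_one, one_mul, zero_add] at hr
      exact (hφ1 r ⟨hr0, hr1⟩ (le_antisymm (by linarith) (hφpos 1 r ⟨hr0, hr1⟩))).le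
  · rintro R ⟨f, x, -, -, rfl⟩
    exact Real.sSup_nonneg fun r hr => hr.1
end

section
/- Let m ≥ 2, let 1 ≤ p, q < ∞, and let φ = (φ_n)_{n=0}^∞ ∈ 𝒢 with φ_0(r) ≤ 1 be such that r = 0 is the only zero of φ_1 in [0,1). Then R_{p,q,φ}(𝔻, ℂ^m_∞) = inf{ R_{p,q,φ}(f, 𝔻, ℂ^m_∞) : f analytic on 𝔻 with values in ℂ^m_∞, ‖f(z)‖_∞ ≤ 1 on 𝔻 } is equal to 0, where for f(z) = Σ_{n=0}^∞ x_n z^n one sets R_{p,q,φ}(f, 𝔻, ℂ^m_∞) = sup{ r ≥ 0 : ‖x_0‖_∞^p φ_0(r) + (Σ_{n=1}^∞ ‖x_n‖_∞ φ_n(r))^q ≤ φ_0(r) }. -/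
open Filter Metric Set

/-- Let `m ≥ 2`, `1 ≤ p, q < ∞`, and `φ = (φ_n) ∈ 𝒢` with `φ_0 ≤ 1`, such that `r = 0` is the
only zero of `φ_1` in `[0,1)`. Then the Bohr radius `R_{p,q,φ}(𝔻, ℂ^m_∞)` equals `0`.
Here `ℂ^m_∞` is modelled as `Fin m → ℂ` with the sup norm. -/
theorem bohr_radius_pq_sup_norm_eq_zero (m : ℕ) (hm : 2 ≤ m) (p q : ℝ)
    (hp : 1 ≤ p) (hq : 1 ≤ q) (φ : ℕ → ℝ → ℝ)
    (hφpos : ∀ n, ∀ r ∈ Ico (0:ℝ) 1, 0 ≤ φ n r)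
    (hφcont : ∀ n, ContinuousOn (φ n) (Ico (0:ℝ) 1))
    (hφconv : TendstoLocallyUniformlyOn
      (fun N r => ∑ n ∈ Finset.range N, φ n r)
      (fun r => ∑' n, φ n r) atTop (Ico (0:ℝ) 1))
    (hφ0 : ∀ r ∈ Ico (0:ℝ) 1, φ 0 r ≤ 1)
    (hφ1 : ∀ r ∈ Ico (0:ℝ) 1, φ 1 r = 0 → r = 0) :
    sInf { R : ℝ | ∃ (f : ℂ → (Fin m → ℂ)) (x : ℕ → Fin m → ℂ),
        (∀ z ∈ ball (0:ℂ) 1, HasSum (fun n => z ^ n • x n) (f z)) ∧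
        (∀ z ∈ ball (0:ℂ) 1, ‖f z‖ ≤ 1) ∧
        R = sSup { r : ℝ | 0 ≤ r ∧ r < 1 ∧
          ‖x 0‖ ^ p * φ 0 r + (∑' n, ‖x (n+1)‖ * φ (n+1) r) ^ q ≤ φ 0 r } } = 0 := by
  obtain ⟨m, rfl⟩ := Nat.exists_eq_add_of_le' hm
  have norm_single (i : Fin (m + 2)) : ‖(Pi.single i 1 : Fin (m + 2) → ℂ)‖ = 1 := by
    rw [Pi.norm_single, norm_one]
  apply IsLeast.csInf_eq
  refine ⟨⟨fun z => Pi.single 0 1 + z • Pi.single 1 1,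
    fun n => if n = 0 then Pi.single 0 1 else if n = 1 then Pi.single 1 1 else 0, ?_, ?_, ?_⟩, ?_⟩
  · intro z _
    convert hasSum_sum_of_ne_finset_zero (s := Finset.range 2) ?_ using 1
    · simp [Finset.sum_range_succ]
    · intro n hn
      have h₂ : 1 < n := by simpa using hn
      simp [show n ≠ 0 by lia, show n ≠ 1 by lia]
    · infer_instance
  · intro z hz
    have hz' : ‖z‖ ≤ 1 := (mem_ball_zero_iff.1 hz).le
    refine (pi_norm_le_iff_of_nonneg zero_le_one).2 fun i => ?_
    by_cases h0 : i = 0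
    · simp [h0]
    · by_cases h1 : i = 1
      · simpa [h1] using hz'
      · simp [h0, h1]
  · symm
    refine le_antisymm (Real.sSup_nonpos ?_) (Real.sSup_nonneg fun r hr => hr.1)
    rintro r ⟨hr0, hr1, hr⟩
    rw [tsum_eq_single 0 fun n hn => by simp [hn]] at hr
    simp only [↓reduceIte, zero_add, one_ne_zero, norm_single, Real.one_rpow, one_mul] at hr
    refine (hφ1 r ⟨hr0, hr1⟩ ?_).le
    by_contra hne
    have hpos : 0 < φ 1 r := (hφpos 1 r ⟨hr0, hr1⟩).lt_of_ne' hne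
    linarith [Real.rpow_pos_of_pos hpos q]
  · rintro R ⟨f, x, -, -, rfl⟩
    exact Real.sSup_nonneg fun r hr => hr.1
end
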